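/- arXiv:2208.01788 — 2 statements merged into one kernel-verified Lean document; each statement's English description precedes it below -/
import Mathlib

section
/- Let C be a field, F a subfield of C, and f a formal power series in C[[z₁,…,z_n]] which, as an element of the fraction field, equals a rational function in F(z₁,…,z_n). Then there exist polynomials A, B ∈ F[z₁,…,z_n] with f = A/B and B(0,…,0) ≠ 0. -/
set_option synthInstance.maxHeartbeats 400000

/-- A polynomial divisible by `B` as a power series lies in every `(B) + 𝔪 ^ k`, where `𝔪` is the
ideal of the variables. -/
theorem MvPolynomial.sub_mul_truncTotal_mem_pow_idealOfVars {σ R : Type*} [Finite σ] [CommRing R]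
    {A B : MvPolynomial σ R} {g : MvPowerSeries σ R}
    (h : (A : MvPowerSeries σ R) = B * g) (k : ℕ) :
    A - B * g.truncTotal k ∈ MvPolynomial.idealOfVars σ R ^ k := by
  classical
  refine (MvPolynomial.mem_pow_idealOfVars_iff' ..).mpr fun d hd ↦ ?_
  rw [MvPolynomial.coeff_sub, sub_eq_zero, ← MvPolynomial.coeff_coe A, h,
    MvPowerSeries.coeff_mul, MvPolynomial.coeff_mul]
  refine Finset.sum_congr rfl fun p hp ↦ ?_
  have hle : p.2 ≤ d := (Finset.HasAntidiagonal.mem_antidiagonal.mp hp) ▸ self_le_add_left p.2 p.1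
  rw [MvPolynomial.coeff_coe,
    MvPowerSeries.coeff_truncTotal _ ((Finsupp.degree_mono hle).trans_lt hd)]

/-- If a polynomial `B` divides a polynomial `A` as a power series, then `B` divides a multiple
`D * A` with `D` of constant coefficient `1`. -/
theorem MvPolynomial.exists_constantCoeff_eq_one_and_dvd_mul {σ R : Type*} [Finite σ] [CommRing R]
    [IsNoetherianRing R] {A B : MvPolynomial σ R}
    (h : (B : MvPowerSeries σ R) ∣ A) :
    ∃ D : MvPolynomial σ R, MvPolynomial.constantCoeff D = 1 ∧ B ∣ D * A := by
  obtain ⟨g, hg⟩ := h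
  let I := MvPolynomial.idealOfVars σ R
  let J := Ideal.span {B}
  have hA : Ideal.Quotient.mk J A ∈
      (⨅ k : ℕ, I ^ k • ⊤ : Submodule (MvPolynomial σ R) (MvPolynomial σ R ⧸ J)) := by
    refine (Submodule.mem_iInf _).mpr fun k ↦ ?_
    have hmem := Submodule.smul_mem_smul
      (MvPolynomial.sub_mul_truncTotal_mem_pow_idealOfVars hg k)
      (Submodule.mem_top (R := MvPolynomial σ R) (x := (1 : MvPolynomial σ R ⧸ J)))
    have hB : Ideal.Quotient.mk J B = 0 :=
      Ideal.Quotient.eq_zero_iff_mem.mpr (Ideal.mem_span_singleton_self B)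
    have hsmul : (A - B * g.truncTotal k) • (1 : MvPolynomial σ R ⧸ J) = Ideal.Quotient.mk J A := by
      change Ideal.Quotient.mk J (A - B * g.truncTotal k) * 1 = _
      rw [mul_one, map_sub, map_mul, hB, zero_mul, sub_zero]
    exact hsmul ▸ hmem
  obtain ⟨⟨r, hr⟩, hrA⟩ := (Ideal.mem_iInf_smul_pow_eq_bot_iff I _).mp hA
  refine ⟨1 - r, ?_, ?_⟩
  · have hr0 : MvPolynomial.constantCoeff r = 0 := by
      have hle : I ≤ RingHom.ker (MvPolynomial.constantCoeff (σ := σ) (R := R)) := by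
        refine Ideal.span_le.mpr ?_
        rintro _ ⟨i, rfl⟩
        simp
      exact hle hr
    simp [hr0]
  · rw [← Ideal.mem_span_singleton, ← Ideal.Quotient.eq_zero_iff_mem]
    have hrA' : Ideal.Quotient.mk J r * Ideal.Quotient.mk J A = Ideal.Quotient.mk J A := hrA
    rw [map_mul, map_sub, map_one, sub_mul, one_mul, hrA', sub_self]

/-- Divisibility of polynomials in the power series ring descends along a field extension. -/
theorem MvPolynomial.coe_dvd_coe_of_map_dvd_map {σ F C : Type*} [Field F] [Field C] [Algebra F C]
    {A B : MvPolynomial σ F}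
    (h : (MvPolynomial.map (algebraMap F C) B : MvPowerSeries σ C) ∣
      MvPolynomial.map (algebraMap F C) A) :
    (B : MvPowerSeries σ F) ∣ A := by
  classical
  obtain ⟨f, hf⟩ := h
  obtain ⟨π, hπ⟩ := (Algebra.linearMap F C).exists_leftInverse_of_injective
    (LinearMap.ker_eq_bot.mpr (algebraMap F C).injective)
  have hπ' (a : F) : π (algebraMap F C a) = a := LinearMap.congr_fun hπ a
  let g : MvPowerSeries σ F := fun d ↦ π (MvPowerSeries.coeff d f)
  have hg (d : σ →₀ ℕ) : MvPowerSeries.coeff d g = π (MvPowerSeries.coeff d f) := rfl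
  refine ⟨g, ?_⟩
  ext d
  have hd := congrArg (fun p ↦ π (MvPowerSeries.coeff d p)) hf
  simp only [MvPowerSeries.coeff_mul, MvPolynomial.coeff_coe, MvPolynomial.coeff_map, hπ',
    map_sum, ← Algebra.smul_def, map_smul] at hd
  rw [MvPolynomial.coeff_coe, hd, MvPowerSeries.coeff_mul]
  refine Finset.sum_congr rfl fun p _ ↦ ?_
  rw [MvPolynomial.coeff_coe, smul_eq_mul, hg]

/-- Nishioka's lemma: Let C be a field, F a subfield of C, and f a formal
power series in C[[z₁,…,z_n]] which, in the fraction field, equals a rational function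
with coefficients in F. Then there exist polynomials A, B ∈ F[z₁,…,z_n] with f = A/B
and B(0,…,0) ≠ 0. -/
theorem stmt_6 (n : ℕ) (C : Type*) [Field C] (F : Type*) [Field F] [Algebra F C]
    (f : MvPowerSeries (Fin n) C)
    (hrat : ∃ A B : MvPolynomial (Fin n) F, B ≠ 0 ∧
      algebraMap (MvPowerSeries (Fin n) C) (FractionRing (MvPowerSeries (Fin n) C)) f =
        algebraMap (MvPowerSeries (Fin n) C) (FractionRing (MvPowerSeries (Fin n) C))
            ((MvPolynomial.map (algebraMap F C) A : MvPolynomial (Fin n) C) :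
              MvPowerSeries (Fin n) C) /
          algebraMap (MvPowerSeries (Fin n) C) (FractionRing (MvPowerSeries (Fin n) C))
            ((MvPolynomial.map (algebraMap F C) B : MvPolynomial (Fin n) C) :
              MvPowerSeries (Fin n) C)) :
    ∃ A B : MvPolynomial (Fin n) F, MvPolynomial.constantCoeff B ≠ 0 ∧
      algebraMap (MvPowerSeries (Fin n) C) (FractionRing (MvPowerSeries (Fin n) C)) f =
        algebraMap (MvPowerSeries (Fin n) C) (FractionRing (MvPowerSeries (Fin n) C))
            ((MvPolynomial.map (algebraMap F C) A : MvPolynomial (Fin n) C) :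
              MvPowerSeries (Fin n) C) /
          algebraMap (MvPowerSeries (Fin n) C) (FractionRing (MvPowerSeries (Fin n) C))
            ((MvPolynomial.map (algebraMap F C) B : MvPolynomial (Fin n) C) :
              MvPowerSeries (Fin n) C) := by
  obtain ⟨A, B, hB, hf⟩ := hrat
  have hinj := MvPolynomial.map_injective (σ := Fin n) _ (algebraMap F C).injective
  have hne {P : MvPolynomial (Fin n) F} (hP : P ≠ 0) :
      algebraMap (MvPowerSeries (Fin n) C) (FractionRing (MvPowerSeries (Fin n) C))
        (MvPolynomial.map (algebraMap F C) P : MvPolynomial (Fin n) C) ≠ 0 := by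
    rw [Ne, FaithfulSMul.algebraMap_eq_zero_iff, MvPolynomial.coe_eq_zero_iff]
    exact (map_ne_zero_iff _ hinj).mpr hP
  rw [eq_div_iff (hne hB), ← map_mul] at hf
  have hfAB := FaithfulSMul.algebraMap_injective _ _ hf
  obtain ⟨D, hD, E, hE⟩ := MvPolynomial.exists_constantCoeff_eq_one_and_dvd_mul
    (MvPolynomial.coe_dvd_coe_of_map_dvd_map
      (Dvd.intro_left f hfAB))
  have hD0 : MvPolynomial.constantCoeff D ≠ 0 := hD ▸ one_ne_zero
  refine ⟨E, D, hD0, ?_⟩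
  rw [eq_div_iff (hne (by rintro rfl; simp at hD0)), ← map_mul]
  congr 1
  have hBC : ((MvPolynomial.map (algebraMap F C) B : MvPolynomial (Fin n) C) :
      MvPowerSeries (Fin n) C) ≠ 0 := fun h0 ↦ hne hB (by rw [h0, map_zero])
  have hE' := congrArg
    (fun P ↦ ((MvPolynomial.map (algebraMap F C) P : MvPolynomial (Fin n) C) :
      MvPowerSeries (Fin n) C)) hE
  simp only [map_mul, MvPolynomial.coe_mul] at hE'
  refine mul_left_cancel₀ hBC ?_
  rw [← hE', ← hfAB]
  ring
end

section
/- Let Ω be an n×n nonsingular matrix with nonnegative integer entries, and let A, B ∈ C[z₁,…,z_n] be coprime polynomials over a field C. Then the greatest common divisor of A(Ωz) and B(Ωz) is a monomial z₁^{I₁}⋯z_n^{I_n} for some nonnegative integers I₁,…,I_n. -/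
set_option synthInstance.maxHeartbeats 400000

namespace Polynomial

/-- Relatively prime polynomials over a unique factorization domain become coprime over the
fraction field. -/
theorem isCoprime_map_fractionRing_of_isRelPrime {S : Type*} [CommRing S] [IsDomain S]
    [UniqueFactorizationMonoid S] {A B : S[X]} (h : IsRelPrime A B) :
    IsCoprime (A.map (algebraMap S (FractionRing S))) (B.map (algebraMap S (FractionRing S))) := by
  set K := FractionRing S
  have hinj : Function.Injective (algebraMap S K) := IsFractionRing.injective S K
  obtain ⟨inst⟩ : Nonempty (NormalizedGCDMonoid S) := inferInstance
  refine EuclideanDomain.isCoprime_of_dvd ?_ ?_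
  · rintro ⟨hA, hB⟩
    rw [Polynomial.map_eq_zero_iff hinj] at hA hB
    subst hA hB
    exact not_isUnit_zero (h (dvd_refl _) (dvd_refl _))
  · intro g hg hg0 hgA hgB
    refine hg ?_
    set N := IsLocalization.integerNormalization (nonZeroDivisors S) g
    obtain ⟨b, hb, hbN⟩ := IsLocalization.integerNormalization_spec (nonZeroDivisors S) g
    have hb0 : algebraMap S K b ≠ 0 := by
      rw [Ne, map_eq_zero_iff _ hinj]
      exact nonZeroDivisors.ne_zero hb
    have hpg : N.primPart.map (algebraMap S K) ∣ g := by
      have h1 : N.primPart.map (algebraMap S K) ∣ C (algebraMap S K b) * g := by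
        have : C (algebraMap S K b) * g = N.map (algebraMap S K) := by
          rw [hbN, Algebra.smul_def, IsScalarTower.algebraMap_apply S K K[X]]
          rfl
        rw [this]
        exact Polynomial.map_dvd _ N.primPart_dvd
      exact (isUnit_C.2 (isUnit_iff_ne_zero.2 hb0)).dvd_mul_left.1 h1
    have hp := N.isPrimitive_primPart
    exact isUnit_or_eq_zero_of_isUnit_integerNormalization_primPart hg0
      (h (hp.dvd_of_fraction_map_dvd_fraction_map (hpg.trans hgA))
        (hp.dvd_of_fraction_map_dvd_fraction_map (hpg.trans hgB)))

/-- The ideal generated by two relatively prime polynomials over a unique factorization domain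
contains a nonzero constant. -/
theorem exists_mul_add_mul_eq_C_of_isRelPrime {S : Type*} [CommRing S] [IsDomain S]
    [UniqueFactorizationMonoid S] {A B : S[X]} (h : IsRelPrime A B) :
    ∃ (p q : S[X]) (s : S), s ≠ 0 ∧ A * p + B * q = C s := by
  have hinj : Function.Injective (algebraMap S (FractionRing S)) := IsFractionRing.injective S _
  by_cases hd : A.natDegree ≠ 0 ∨ B.natDegree ≠ 0
  · obtain ⟨p, q, -, -, hpq⟩ := exists_mul_add_mul_eq_C_resultant A B le_rfl le_rfl hd
    refine ⟨p, q, _, fun h0 => ?_, hpq⟩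
    have h1 := resultant_map_map A B A.natDegree B.natDegree (algebraMap S (FractionRing S))
    rw [h0, map_zero, ← natDegree_map_eq_of_injective hinj A,
      ← natDegree_map_eq_of_injective hinj B] at h1
    exact (resultant_eq_zero_iff.1 h1).2 (isCoprime_map_fractionRing_of_isRelPrime h)
  · push Not at hd
    obtain ⟨a, rfl⟩ := natDegree_eq_zero.1 hd.1
    obtain ⟨b, rfl⟩ := natDegree_eq_zero.1 hd.2
    by_cases ha : a = 0
    · refine ⟨0, 1, b, ?_, by simp⟩
      rintro rfl
      subst ha
      exact not_isUnit_zero (h (by simp) (by simp))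
    · exact ⟨1, 0, a, ha, by simp⟩

end Polynomial

namespace MvPolynomial

/-- The ideal generated by two relatively prime polynomials over a field contains a nonzero
polynomial in which a given variable does not occur. -/
theorem exists_mul_add_mul_eq_notMem_vars_of_isRelPrime {σ K : Type*} [Field K]
    {A B : MvPolynomial σ K} (h : IsRelPrime A B) (i : σ) :
    ∃ p q r : MvPolynomial σ K, r ≠ 0 ∧ i ∉ r.vars ∧ A * p + B * q = r := by
  classical
  let e : MvPolynomial σ K ≃ₐ[K] Polynomial (MvPolynomial {j // j ≠ i} K) :=
    (renameEquiv K (Equiv.optionSubtypeNe i).symm).trans (optionEquivLeft K _)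
  have hrel : IsRelPrime (e A) (e B) := by
    refine IsRelPrime.of_map e.symm ?_
    simpa using h
  obtain ⟨p, q, s, hs, hpq⟩ := Polynomial.exists_mul_add_mul_eq_C_of_isRelPrime hrel
  have he : e (rename Subtype.val s) = Polynomial.C s := by
    have : (e.toAlgHom.comp (rename Subtype.val)) =
        IsScalarTower.toAlgHom K (MvPolynomial {j // j ≠ i} K)
          (Polynomial (MvPolynomial {j // j ≠ i} K)) := by
      ext ⟨j, hj⟩ : 1
      simp [e, Equiv.optionSubtypeNe_symm_of_ne hj]
    exact DFunLike.congr_fun this s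
  refine ⟨e.symm p, e.symm q, rename Subtype.val s, ?_, ?_, ?_⟩
  · rwa [Ne, map_eq_zero_iff _ (rename_injective _ Subtype.val_injective)]
  · intro hi
    obtain ⟨j, -, hj⟩ := Finset.mem_image.1 (vars_rename _ _ hi)
    exact j.2 hj
  · apply e.injective
    simp [he, hpq]

/-- The support of a product of nonzero polynomials contains a sum of two exponents which maximize
a given additive weight on the supports of the factors. -/
theorem exists_add_mem_support_mul_forall_le {σ R : Type*} [CommRing R] [IsDomain R]
    (w : (σ →₀ ℕ) →+ ℤ) {p q : MvPolynomial σ R} (hp : p ≠ 0) (hq : q ≠ 0) :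
    ∃ u v, u + v ∈ (p * q).support ∧ (∀ u' ∈ p.support, w u' ≤ w u) ∧
      ∀ v' ∈ q.support, w v' ≤ w v := by
  classical
  obtain ⟨a, ha, hamax⟩ := p.support.exists_max_image w (support_nonempty.2 hp)
  obtain ⟨b, hb, hbmax⟩ := q.support.exists_max_image w (support_nonempty.2 hq)
  obtain ⟨u, hu, v, hv, huv⟩ := UniqueSums.uniqueAdd_of_nonempty
    (A := p.support.filter (w · = w a)) (B := q.support.filter (w · = w b))
    ⟨a, by simp [mem_support_iff.1 ha]⟩ ⟨b, by simp [mem_support_iff.1 hb]⟩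
  rw [Finset.mem_filter] at hu hv
  refine ⟨u, v, ?_, fun u' hu' => hu.2 ▸ hamax u' hu', fun v' hv' => hv.2 ▸ hbmax v' hv'⟩
  rw [mem_support_iff, coeff_mul, Finset.sum_eq_single (u, v)]
  · exact mul_ne_zero (mem_support_iff.1 hu.1) (mem_support_iff.1 hv.1)
  · rintro ⟨x, y⟩ hxy hne
    rw [Finset.HasAntidiagonal.mem_antidiagonal] at hxy
    by_contra h0
    have hx : x ∈ p.support := mem_support_iff.2 (left_ne_zero_of_mul h0)
    have hy : y ∈ q.support := mem_support_iff.2 (right_ne_zero_of_mul h0)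
    have hw : w x + w y = w u + w v := by rw [← map_add, ← map_add, hxy]
    have h1 := hamax x hx
    have h2 := hbmax y hy
    obtain ⟨rfl, rfl⟩ := huv (Finset.mem_filter.2 ⟨hx, by lia⟩)
      (Finset.mem_filter.2 ⟨hy, by lia⟩) hxy
    exact hne rfl
  · simp

/-- A divisor of a nonzero polynomial of weight zero is weighted homogeneous. -/
theorem weight_eq_of_dvd_of_forall_eq_zero {σ R : Type*} [CommRing R] [IsDomain R]
    (w : (σ →₀ ℕ) →+ ℤ) {d f : MvPolynomial σ R} (hf : f ≠ 0) (hdf : d ∣ f)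
    (hw : ∀ u ∈ f.support, w u = 0) {u v : σ →₀ ℕ} (hu : u ∈ d.support) (hv : v ∈ d.support) :
    w u = w v := by
  obtain ⟨e, rfl⟩ := hdf
  have hd := left_ne_zero_of_mul hf
  have he := right_ne_zero_of_mul hf
  obtain ⟨a, b, hab, ha, hb⟩ := exists_add_mem_support_mul_forall_le w hd he
  obtain ⟨a', b', hab', ha', hb'⟩ := exists_add_mem_support_mul_forall_le (-w) hd he
  obtain ⟨y, hy⟩ := support_nonempty.2 he
  have h1 := hw _ hab
  have h2 := hw _ hab'
  rw [map_add] at h1 h2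
  have := ha u hu
  have := ha v hv
  have := ha' u hu
  have := ha' v hv
  have := hb y hy
  have := hb' y hy
  simp only [AddMonoidHom.neg_apply] at *
  lia

theorem monomial_one_dvd_of_forall_le {σ R : Type*} [CommRing R] {I : σ →₀ ℕ}
    {p : MvPolynomial σ R} (h : ∀ u ∈ p.support, I ≤ u) : monomial I (1 : R) ∣ p := by
  rw [p.as_sum]
  exact Finset.dvd_sum fun u hu => monomial_dvd_monomial.2 ⟨Or.inr (h u hu), one_dvd _⟩

theorem le_of_monomial_dvd {σ R : Type*} [CommRing R] {I u : σ →₀ ℕ} {c : R}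
    {p : MvPolynomial σ R} (h : monomial I c ∣ p) (hu : u ∈ p.support) : I ≤ u := by
  classical
  obtain ⟨q, rfl⟩ := h
  rw [mem_support_iff, coeff_monomial_mul'] at hu
  by_contra hI
  exact hu (if_neg hI)

section MonomialSubstitution

variable {σ : Type*} [Fintype σ] (Ω : Matrix σ σ ℕ)

/-- The map on exponents induced by the substitution `X i ↦ ∏ j, X j ^ Ω i j`. -/
noncomputable def substExponent (v : σ →₀ ℕ) : σ →₀ ℕ :=
  Finsupp.equivFunOnFinite.symm fun j => ∑ i, Ω i j * v i

theorem aeval_prod_X_pow_eq_sum {R : Type*} [CommRing R] (p : MvPolynomial σ R) :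
    aeval (fun i => ∏ j, (X j : MvPolynomial σ R) ^ Ω i j) p =
      ∑ v ∈ p.support, monomial (substExponent Ω v) (coeff v p) := by
  rw [aeval_def, eval₂_eq']
  refine Finset.sum_congr rfl fun v _ => ?_
  rw [monomial_eq, Finsupp.prod_fintype _ _ (by simp)]
  simp_rw [← Finset.prod_pow, ← pow_mul]
  rw [Finset.prod_comm]
  simp [substExponent, Finset.prod_pow_eq_pow_sum, algebraMap_eq]

variable [DecidableEq σ]

/-- The weight given by a column of the adjugate of `Ω`. -/
def adjugateWeight (i : σ) : (σ →₀ ℕ) →+ ℤ where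
  toFun u := ∑ j, (u j : ℤ) * (Ω.map (Nat.cast : ℕ → ℤ)).adjugate j i
  map_zero' := by simp
  map_add' u v := by simp [add_mul, Finset.sum_add_distrib]

theorem adjugateWeight_substExponent (i : σ) (v : σ →₀ ℕ) :
    adjugateWeight Ω i (substExponent Ω v) = (Ω.map (Nat.cast : ℕ → ℤ)).det * v i := by
  have h : ∀ k, ∑ j, (Ω k j : ℤ) * (Ω.map (Nat.cast : ℕ → ℤ)).adjugate j i =
      if k = i then (Ω.map (Nat.cast : ℕ → ℤ)).det else 0 := fun k => by
    have := congr_fun₂ (Ω.map (Nat.cast : ℕ → ℤ)).mul_adjugate k i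
    simpa [Matrix.mul_apply, Matrix.one_apply] using this
  simp only [adjugateWeight, AddMonoidHom.coe_mk, ZeroHom.coe_mk, substExponent,
    Finsupp.equivFunOnFinite_symm_apply_apply, Nat.cast_sum, Nat.cast_mul, Finset.sum_mul]
  rw [Finset.sum_comm]
  have h2 : ∀ k, ∑ j, (Ω k j : ℤ) * v k * (Ω.map (Nat.cast : ℕ → ℤ)).adjugate j i =
      (if k = i then (Ω.map (Nat.cast : ℕ → ℤ)).det else 0) * v k := fun k => by
    rw [← h k, Finset.sum_mul]
    exact Finset.sum_congr rfl fun j _ => by ring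
  simp [h2]

variable {Ω}

theorem substExponent_injective (hΩ : (Ω.map (Nat.cast : ℕ → ℤ)).det ≠ 0) :
    Function.Injective (substExponent Ω) := by
  intro u v huv
  ext i
  have h := congr_arg (adjugateWeight Ω i) huv
  rw [adjugateWeight_substExponent, adjugateWeight_substExponent] at h
  exact_mod_cast mul_left_cancel₀ hΩ h

theorem eq_of_adjugateWeight_eq (hΩ : (Ω.map (Nat.cast : ℕ → ℤ)).det ≠ 0)
    {u v : σ →₀ ℕ}
    (h : ∀ i, adjugateWeight Ω i u = adjugateWeight Ω i v) : u = v := by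
  have h1 : Matrix.vecMul (fun j => (u j : ℤ)) (Ω.map (Nat.cast : ℕ → ℤ)).adjugate =
      Matrix.vecMul (fun j => (v j : ℤ)) (Ω.map (Nat.cast : ℕ → ℤ)).adjugate := _root_.funext h
  have h2 := congr_arg (Matrix.vecMul · (Ω.map (Nat.cast : ℕ → ℤ))) h1
  simp only [Matrix.vecMul_vecMul, Matrix.adjugate_mul, Matrix.vecMul_smul,
    Matrix.vecMul_one] at h2
  ext i
  have h3 := congr_fun h2 i
  simp only [Pi.smul_apply, smul_eq_mul] at h3
  exact_mod_cast mul_left_cancel₀ hΩ h3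

theorem aeval_prod_X_pow_ne_zero (hΩ : (Ω.map (Nat.cast : ℕ → ℤ)).det ≠ 0)
    {R : Type*} [CommRing R] {p : MvPolynomial σ R} (hp : p ≠ 0) :
    aeval (fun i => ∏ j, (X j : MvPolynomial σ R) ^ Ω i j) p ≠ 0 := by
  obtain ⟨u, hu⟩ := support_nonempty.2 hp
  intro h0
  refine mem_support_iff.1 hu ?_
  have h1 := congr_arg (coeff (substExponent Ω u)) h0
  rw [aeval_prod_X_pow_eq_sum, coeff_sum, Finset.sum_eq_single u] at h1
  · simpa using h1
  · intro v _ hv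
    rw [coeff_monomial, if_neg fun h => hv (substExponent_injective hΩ h)]
  · exact fun h => absurd hu h

/-- A common divisor of the images of two relatively prime polynomials under a nonsingular monomial
substitution is a monomial. -/
theorem exists_eq_monomial_of_dvd_aeval_prod_X_pow
    (hΩ : (Ω.map (Nat.cast : ℕ → ℤ)).det ≠ 0) {K : Type*} [Field K]
    {A B d : MvPolynomial σ K} (h : IsRelPrime A B)
    (hA : d ∣ aeval (fun i => ∏ j, (X j : MvPolynomial σ K) ^ Ω i j) A)
    (hB : d ∣ aeval (fun i => ∏ j, (X j : MvPolynomial σ K) ^ Ω i j) B) :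
    ∃ u c, c ≠ 0 ∧ d = monomial u c := by
  have hd : d ≠ 0 := by
    rintro rfl
    have hA0 : A = 0 := by_contra fun h0 => aeval_prod_X_pow_ne_zero hΩ h0 (zero_dvd_iff.1 hA)
    have hB0 : B = 0 := by_contra fun h0 => aeval_prod_X_pow_ne_zero hΩ h0 (zero_dvd_iff.1 hB)
    subst hA0 hB0
    exact not_isUnit_zero (h dvd_rfl dvd_rfl)
  obtain ⟨u, hu⟩ := support_nonempty.2 hd
  refine ⟨u, coeff u d, mem_support_iff.1 hu, ?_⟩
  have huniq : ∀ v ∈ d.support, v = u := fun v hv => by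
    refine eq_of_adjugateWeight_eq hΩ fun i => ?_
    obtain ⟨p, q, r, hr, hir, hpq⟩ := exists_mul_add_mul_eq_notMem_vars_of_isRelPrime h i
    refine weight_eq_of_dvd_of_forall_eq_zero _ (aeval_prod_X_pow_ne_zero hΩ hr) ?_ ?_ hv hu
    · rw [← hpq, map_add, map_mul, map_mul]
      exact dvd_add (hA.mul_right _) (hB.mul_right _)
    · intro x hx
      rw [aeval_prod_X_pow_eq_sum] at hx
      obtain ⟨y, hy, hxy⟩ := Finset.mem_biUnion.1 (support_sum hx)
      have hxy' := Finset.mem_singleton.1 (support_monomial_subset hxy)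
      rw [hxy', adjugateWeight_substExponent]
      have : y i = 0 := by
        by_contra hyi
        exact hir (mem_vars_iff_mem_support i |>.2 ⟨y, hy, Finsupp.mem_support_iff.2 hyi⟩)
      simp [this]
  conv_lhs => rw [d.as_sum]
  rw [Finset.sum_eq_single u]
  · exact fun v hv hvu => absurd (huniq v hv) hvu
  · exact fun h => absurd hu h

end MonomialSubstitution

end MvPolynomial

/-- Let Ω be an n×n nonsingular matrix with nonnegative integer entries,
and let A, B ∈ C[z₁,…,z_n] be coprime polynomials over a field C (of characteristic 0).
Then a greatest common divisor of A(Ωz) and B(Ωz) is a monomial z₁^{I₁}⋯z_n^{I_n}. -/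
theorem stmt_7 (n : ℕ) (Ω : Matrix (Fin n) (Fin n) ℕ)
    (hdet : (Ω.map (Nat.cast : ℕ → ℚ)).det ≠ 0)
    (C : Type*) [Field C] [CharZero C] (A B : MvPolynomial (Fin n) C)
    (hcop : ∀ d : MvPolynomial (Fin n) C, d ∣ A → d ∣ B → IsUnit d) :
    ∃ I : Fin n →₀ ℕ,
      (MvPolynomial.monomial I (1 : C) ∣
        MvPolynomial.aeval (fun i : Fin n => ∏ j : Fin n, MvPolynomial.X j ^ Ω i j) A) ∧
      (MvPolynomial.monomial I (1 : C) ∣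
        MvPolynomial.aeval (fun i : Fin n => ∏ j : Fin n, MvPolynomial.X j ^ Ω i j) B) ∧
      ∀ d : MvPolynomial (Fin n) C,
        d ∣ MvPolynomial.aeval (fun i : Fin n => ∏ j : Fin n, MvPolynomial.X j ^ Ω i j) A →
        d ∣ MvPolynomial.aeval (fun i : Fin n => ∏ j : Fin n, MvPolynomial.X j ^ Ω i j) B →
        d ∣ MvPolynomial.monomial I (1 : C) := by
  classical
  have hΩ : (Ω.map (Nat.cast : ℕ → ℤ)).det ≠ 0 := by
    intro h0
    apply hdet
    have h1 := congr_arg (Int.castRingHom ℚ) h0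
    rw [RingHom.map_det, map_zero] at h1
    rw [← h1]
    congr 1
  have hrel : IsRelPrime A B := fun d => hcop d
  have hmon := fun d => MvPolynomial.exists_eq_monomial_of_dvd_aeval_prod_X_pow (d := d) hΩ hrel
  set F := MvPolynomial.aeval
    (fun i : Fin n => ∏ j : Fin n, (MvPolynomial.X j : MvPolynomial (Fin n) C) ^ Ω i j) A
  set G := MvPolynomial.aeval
    (fun i : Fin n => ∏ j : Fin n, (MvPolynomial.X j : MvPolynomial (Fin n) C) ^ Ω i j) B
  have hne : (F.support ∪ G.support).Nonempty := by
    rw [Finset.nonempty_iff_ne_empty]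
    intro h0
    rw [Finset.union_eq_empty, MvPolynomial.support_eq_empty, MvPolynomial.support_eq_empty] at h0
    obtain ⟨u, c, hc, h⟩ := hmon 0 (by simp [h0.1]) (by simp [h0.2])
    exact hc (MvPolynomial.monomial_eq_zero.1 h.symm)
  have hle : ∀ u ∈ F.support ∪ G.support, (F.support ∪ G.support).inf' hne id ≤ u :=
    fun u hu => Finset.inf'_le id hu
  refine ⟨(F.support ∪ G.support).inf' hne id,
    MvPolynomial.monomial_one_dvd_of_forall_le fun u hu => hle u (Finset.mem_union_left _ hu),
    MvPolynomial.monomial_one_dvd_of_forall_le fun u hu => hle u (Finset.mem_union_right _ hu),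
    fun d hA hB => ?_⟩
  obtain ⟨u, c, hc, rfl⟩ := hmon d hA hB
  refine MvPolynomial.monomial_dvd_monomial.2 ⟨Or.inr ?_, (isUnit_iff_ne_zero.2 hc).dvd⟩
  refine Finset.le_inf' _ _ fun v hv => ?_
  rcases Finset.mem_union.1 hv with hv | hv
  · exact MvPolynomial.le_of_monomial_dvd hA hv
  · exact MvPolynomial.le_of_monomial_dvd hB hv
end
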